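/- Under Assumptions 1 and 2, every solution x of the switched system ẋ(t) = f_{σ(t)}(x(t)) satisfies, for every t > 0, the bound V_{σ(t)}(x(t)) ≤ V_{σ(0)}(x(0)) · exp( t · ( ν(t) · Σ_{(k,ℓ)∈E(P)} (ln μ_{kℓ}) ρ_{kℓ}(t) − Σ_{j∈P_S} |λ_j| η_j(t) + Σ_{k∈P_U} |λ_k| η_k(t) ) ). -/

import Mathlib

open Filter MeasureTheory Set

noncomputable section

/-- A switching signal: strictly increasing switching instants `tau 0 = 0 < tau 1 < ...`
tending to `+∞`, together with the signal `sig` itself, constant on `[tau i, tau (i+1))`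
and actually switching at each `tau (i+1)`. -/
structure SwitchSig (P : Type*) where
  tau : ℕ → ℝ
  sig : ℝ → P
  tau0 : tau 0 = 0
  mono : StrictMono tau
  tends : Filter.Tendsto tau Filter.atTop Filter.atTop
  const : ∀ i : ℕ, ∀ t : ℝ, tau i ≤ t → t < tau (i + 1) → sig t = sig (tau i)
  switch : ∀ i : ℕ, sig (tau i) ≠ sig (tau (i + 1))

namespace SwitchSig

variable {P : Type*} (S : SwitchSig P)

/-- `N s t` : the number of switching instants in `(s, t]`. -/
def N (s t : ℝ) : ℕ := Set.ncard {i : ℕ | s < S.tau i ∧ S.tau i ≤ t}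

/-- `Ntrans k l t` : the number of transitions from `k` to `l` occurring up to time `t`. -/
def Ntrans (k l : P) (t : ℝ) : ℕ :=
  Set.ncard {i : ℕ | S.tau (i + 1) ≤ t ∧ S.sig (S.tau i) = k ∧ S.sig (S.tau (i + 1)) = l}

/-- `Nmode j s t` : the number of switching instants in `(s, t]` at which subsystem `j`
is activated. -/
def Nmode (j : P) (s t : ℝ) : ℕ :=
  Set.ncard {i : ℕ | s < S.tau i ∧ S.tau i ≤ t ∧ S.sig (S.tau i) = j}

/-- `T j s t` : the total duration of activation of subsystem `j` on `(s, t]`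
(Lebesgue measure). -/
def T (j : P) (s t : ℝ) : ℝ :=
  (MeasureTheory.volume {r : ℝ | s < r ∧ r ≤ t ∧ S.sig r = j}).toReal

/-- switching frequency `ν(t) = N(0,t)/t`. -/
def nu (t : ℝ) : ℝ := (S.N 0 t : ℝ) / t

/-- transition frequency `ρ_{kl}(t) = N_{kl}(0,t)/N(0,t)`. -/
def rho (k l : P) (t : ℝ) : ℝ := (S.Ntrans k l t : ℝ) / (S.N 0 t : ℝ)

/-- fraction of activation `η_j(t) = T_j(0,t)/t`. -/
def eta (j : P) (t : ℝ) : ℝ := S.T j 0 t / t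

end SwitchSig

/-- A (Carathéodory-type) solution of the switched system `ẋ = f_{σ(t)}(x)`:
continuous on `[0, ∞)` and differentiable, with the prescribed derivative, in the
interior of every inter-switch interval. -/
def IsSolution {P : Type*} {E : Type*} [NormedAddCommGroup E] [NormedSpace ℝ E]
    (S : SwitchSig P) (f : P → E → E) (x : ℝ → E) : Prop :=
  ContinuousOn x (Set.Ici (0 : ℝ)) ∧
  ∀ i : ℕ, ∀ t : ℝ, S.tau i < t → t < S.tau (i + 1) →
    HasDerivAt x (f (S.sig t) (x t)) t

/-- Class `K∞` functions. -/
def ClassKInf (g : ℝ → ℝ) : Prop :=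
  ContinuousOn g (Set.Ici (0 : ℝ)) ∧ StrictMonoOn g (Set.Ici (0 : ℝ)) ∧ g 0 = 0 ∧
  Filter.Tendsto g Filter.atTop Filter.atTop

/-- Assumption 1: Lyapunov-like functions `V i`, sandwiched between class-`K∞`
functions of the norm, decaying at rate `lam i` (positive on `PS`, negative on `PU`)
along solutions of each subsystem. -/
def Assumption1 {P : Type*} {E : Type*} [NormedAddCommGroup E] [NormedSpace ℝ E]
    (f : P → E → E) (V : P → E → ℝ) (lam : P → ℝ) (PS PU : Finset P)
    (lo hi : ℝ → ℝ) : Prop :=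
  ClassKInf lo ∧ ClassKInf hi ∧
  (∀ i : P, ContDiff ℝ 1 (V i)) ∧
  (∀ i : P, ∀ ξ : E, 0 ≤ V i ξ) ∧
  (∀ j ∈ PS, 0 < lam j) ∧ (∀ k ∈ PU, lam k < 0) ∧
  (∀ i : P, ∀ ξ : E, lo ‖ξ‖ ≤ V i ξ ∧ V i ξ ≤ hi ‖ξ‖) ∧
  (∀ i : P, ∀ γ : ℝ → E, ContinuousOn γ (Set.Ici (0 : ℝ)) →
    (∀ t : ℝ, 0 < t → HasDerivAt γ (f i (γ t)) t) →
    ∀ t : ℝ, 0 ≤ t → V i (γ t) ≤ V i (γ 0) * Real.exp (-(lam i) * t))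

/-- Assumption 2: for every admissible transition `(i, j)` there is `μ_{ij} ≥ 1`
with `V j ≤ μ_{ij} • V i` pointwise. -/
def Assumption2 {P : Type*} {E : Type*}
    (V : P → E → ℝ) (mu : P → P → ℝ) (Eadm : Finset (P × P)) : Prop :=
  ∀ p ∈ Eadm, 1 ≤ mu p.1 p.2 ∧ ∀ ξ : E, V p.2 ξ ≤ mu p.1 p.2 * V p.1 ξ

/-- Global asymptotic stability of the switched system under the switching signal `S`:
Lyapunov stability together with global asymptotic convergence of every solution. -/
def IsGAS {P : Type*} {E : Type*} [NormedAddCommGroup E] [NormedSpace ℝ E]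
    (S : SwitchSig P) (f : P → E → E) : Prop :=
  (∀ ε : ℝ, 0 < ε → ∃ δ : ℝ, 0 < δ ∧ ∀ x : ℝ → E, IsSolution S f x → ‖x 0‖ < δ →
      ∀ t : ℝ, 0 ≤ t → ‖x t‖ < ε) ∧
  ∀ x : ℝ → E, IsSolution S f x → Filter.Tendsto x Filter.atTop (nhds (0 : E))

/-- `γ` is continuous on `[a, b]` and solves `γ' = f γ` on `(a, b)`. -/
def SolvesOn {E : Type*} [NormedAddCommGroup E] [NormedSpace ℝ E]
    (f : E → E) (γ : ℝ → E) (a b : ℝ) : Prop :=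
  ContinuousOn γ (Icc a b) ∧ ∀ t ∈ Ioo a b, HasDerivAt γ (f (γ t)) t

namespace SolvesOn

variable {E : Type*} [NormedAddCommGroup E] [NormedSpace ℝ E] {f : E → E} {γ γ' : ℝ → E}
  {a b c : ℝ}

theorem congr (h : SolvesOn f γ a b) (heq : EqOn γ' γ (Icc a b)) : SolvesOn f γ' a b := by
  refine ⟨h.1.congr heq, fun t ht => ?_⟩
  rw [heq (Ioo_subset_Icc_self ht)]
  refine (h.2 t ht).congr_of_eventuallyEq ?_
  filter_upwards [Icc_mem_nhds ht.1 ht.2] with s hs using heq hs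

theorem hasDerivWithinAt_left (hf : Continuous f) (h : SolvesOn f γ a b) (hab : a < b) :
    HasDerivWithinAt γ (f (γ b)) (Iic b) b := by
  have hc : ContinuousWithinAt γ (Ioo a b) b :=
    (h.1 b (right_mem_Icc.2 hab.le)).mono Ioo_subset_Icc_self
  refine hasDerivWithinAt_Iic_of_tendsto_deriv (s := Ioo a b)
    (fun t ht => (h.2 t ht).differentiableAt.differentiableWithinAt) hc
    (Ioo_mem_nhdsLT hab) ?_
  have h' : Tendsto (fun t => f (γ t)) (nhdsWithin b (Iio b)) (nhds (f (γ b))) := by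
    rw [← nhdsWithin_Ioo_eq_nhdsLT hab]
    exact (hf.tendsto _).comp hc
  refine h'.congr' ?_
  filter_upwards [Ioo_mem_nhdsLT hab] with t ht using (h.2 t ht).deriv.symm

theorem hasDerivWithinAt_right (hf : Continuous f) (h : SolvesOn f γ a b) (hab : a < b) :
    HasDerivWithinAt γ (f (γ a)) (Ici a) a := by
  have hc : ContinuousWithinAt γ (Ioo a b) a :=
    (h.1 a (left_mem_Icc.2 hab.le)).mono Ioo_subset_Icc_self
  refine hasDerivWithinAt_Ici_of_tendsto_deriv (s := Ioo a b)
    (fun t ht => (h.2 t ht).differentiableAt.differentiableWithinAt) hc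
    (Ioo_mem_nhdsGT hab) ?_
  have h' : Tendsto (fun t => f (γ t)) (nhdsWithin a (Ioi a)) (nhds (f (γ a))) := by
    rw [← nhdsWithin_Ioo_eq_nhdsGT hab]
    exact (hf.tendsto _).comp hc
  refine h'.congr' ?_
  filter_upwards [Ioo_mem_nhdsGT hab] with t ht using (h.2 t ht).deriv.symm

/-- Solutions on adjacent intervals which agree at the common endpoint glue to a solution. -/
theorem glue (hf : Continuous f) (hab : a < b) (hbc : b < c)
    (h : SolvesOn f γ a b) (h' : SolvesOn f γ b c) : SolvesOn f γ a c := by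
  constructor
  · rw [← Icc_union_Icc_eq_Icc hab.le hbc.le]
    exact h.1.union_of_isClosed h'.1 isClosed_Icc isClosed_Icc
  · intro t ht
    rcases lt_trichotomy t b with htb | rfl | htb
    · exact h.2 t ⟨ht.1, htb⟩
    · have := (h.hasDerivWithinAt_left hf hab).union (h'.hasDerivWithinAt_right hf hbc)
      rwa [Iic_union_Ici, hasDerivWithinAt_univ] at this
    · exact h'.2 t ⟨htb, ht.2⟩

end SolvesOn

section Extension

variable {E : Type*} [NormedAddCommGroup E] [NormedSpace ℝ E] [CompleteSpace E] {f : E → E}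

/-- A Lipschitz vector field has local solutions on intervals of uniform length. -/
theorem LipschitzWith.exists_uniform_solvesOn {K : NNReal} (hf : LipschitzWith K f) :
    ∃ ε > 0, ∀ (y : E) (t₀ : ℝ), ∃ α : ℝ → E, α t₀ = y ∧ SolvesOn f α t₀ (t₀ + ε) := by
  refine ⟨1 / (K + 1), by positivity, fun y t₀ => ?_⟩
  have hε : (0 : ℝ) < 1 / (K + 1) := by positivity
  have hPL : IsPicardLindelof (fun _ => f) (tmin := t₀) (tmax := t₀ + 1 / (K + 1))
      ⟨t₀, left_mem_Icc.2 (by linarith)⟩ y ‖f y‖₊ 0 (‖f y‖₊ * (K + 1)) K := by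
    refine ⟨fun t _ => hf.lipschitzOnWith, fun _ _ => continuousOn_const, fun t _ z hz => ?_, ?_⟩
    · have h1 : ‖f z - f y‖ ≤ K * ‖z - y‖ := hf.norm_sub_le z y
      have h2 : ‖z - y‖ ≤ ‖f y‖ := by simpa [dist_eq_norm] using hz
      have h3 : ‖f z‖ ≤ ‖f z - f y‖ + ‖f y‖ := by
        simpa using norm_add_le (f z - f y) (f y)
      have h4 := mul_le_mul_of_nonneg_left h2 K.coe_nonneg
      push_cast
      nlinarith
    · have hmax : max (t₀ + 1 / ((K : ℝ) + 1) - t₀) (t₀ - t₀) = 1 / ((K : ℝ) + 1) := by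
        rw [add_sub_cancel_left, sub_self, max_eq_left hε.le]
      have hK : (K : ℝ) + 1 ≠ 0 := by positivity
      simp only [hmax]
      push_cast
      field_simp
      simp
  obtain ⟨α, h0, hα⟩ := hPL.exists_eq_forall_mem_Icc_hasDerivWithinAt₀
  exact ⟨α, h0, fun t ht => (hα t ht).continuousWithinAt,
    fun t ht => (hα t (Ioo_subset_Icc_self ht)).hasDerivAt (Icc_mem_nhds ht.1 ht.2)⟩

/-- A solution of a Lipschitz differential equation extends to all later times. -/
theorem SolvesOn.exists_extension {K : NNReal} (hf : LipschitzWith K f) {γ : ℝ → E} {a b : ℝ}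
    (hab : a < b) (h : SolvesOn f γ a b) :
    ∃ δ : ℝ → E, EqOn δ γ (Iic b) ∧ ContinuousOn δ (Ici a) ∧
      ∀ t, a < t → HasDerivAt δ (f (δ t)) t := by
  obtain ⟨ε, hε, hstep⟩ := hf.exists_uniform_solvesOn
  have hext : ∀ (n : ℕ) (ξ : ℝ → E), ∃ ξ' : ℝ → E, EqOn ξ' ξ (Iic (b + n * ε)) ∧
      (SolvesOn f ξ a (b + n * ε) → SolvesOn f ξ' a (b + (n + 1 : ℕ) * ε)) := by
    intro n ξ
    obtain ⟨α, hα0, hα⟩ := hstep (ξ (b + n * ε)) (b + n * ε)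
    have hn : a < b + n * ε := by
      have : 0 ≤ n * ε := by positivity
      linarith
    have heq : EqOn (fun t => if t ≤ b + n * ε then ξ t else α t) ξ (Iic (b + n * ε)) :=
      fun t ht => if_pos ht
    refine ⟨_, heq, fun hξ => ?_⟩
    have hlast : b + (n + 1 : ℕ) * ε = b + n * ε + ε := by push_cast; ring
    rw [hlast]
    refine (hξ.congr (heq.mono Icc_subset_Iic_self)).glue hf.continuous hn (by linarith)
      (hα.congr fun t ht => ?_)
    rcases ht.1.eq_or_lt with rfl | hlt
    · simp [hα0]
    · exact if_neg hlt.not_ge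
  choose F hF1 hF2 using hext
  let Γ : ℕ → ℝ → E := fun n => Nat.rec γ F n
  have hΓ : ∀ n : ℕ, SolvesOn f (Γ n) a (b + n * ε) := by
    intro n
    induction n with
    | zero => simpa [Γ] using h
    | succ n ih => exact hF2 n _ ih
  have hle : ∀ m n : ℕ, m ≤ n → EqOn (Γ n) (Γ m) (Iic (b + m * ε)) := by
    intro m n hmn
    induction n, hmn using Nat.le_induction with
    | base => exact fun _ _ => rfl
    | succ n hmn ih =>
      intro t ht
      rw [← ih ht]
      refine hF1 n (Γ n) (le_trans (mem_Iic.1 ht) ?_)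
      gcongr
  let δ : ℝ → E := fun t => Γ ⌈(t - b) / ε⌉₊ t
  have hδ : ∀ n : ℕ, EqOn δ (Γ n) (Iic (b + n * ε)) := by
    intro n t ht
    refine (hle _ n (Nat.ceil_le.2 ?_) ?_).symm
    · rw [div_le_iff₀ hε]; linarith [mem_Iic.1 ht]
    · have := (div_le_iff₀ hε).1 (Nat.le_ceil ((t - b) / ε))
      exact mem_Iic.2 (by linarith)
  have hsol : ∀ n : ℕ, SolvesOn f δ a (b + n * ε) := fun n =>
    (hΓ n).congr ((hδ n).mono Icc_subset_Iic_self)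
  have hlarge : ∀ t : ℝ, ∃ n : ℕ, t < b + n * ε := by
    intro t
    obtain ⟨n, hn⟩ := exists_nat_gt ((t - b) / ε)
    exact ⟨n, by linarith [(div_lt_iff₀ hε).1 hn]⟩
  refine ⟨δ, by simpa [Γ] using hδ 0, fun t ht => ?_, fun t ht => ?_⟩
  · obtain ⟨n, hn⟩ := hlarge t
    refine ((hsol n).1 t ⟨ht, hn.le⟩).mono_of_mem_nhdsWithin ?_
    filter_upwards [self_mem_nhdsWithin, mem_nhdsWithin_of_mem_nhds (Iio_mem_nhds hn)]
      with s hs hs' using ⟨hs, hs'.le⟩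
  · obtain ⟨n, hn⟩ := hlarge t
    exact (hsol n).2 t ⟨ht, hn⟩

end Extension

namespace SwitchSig

variable {P : Type*} (S : SwitchSig P)

theorem tau_nonneg (n : ℕ) : 0 ≤ S.tau n := S.tau0 ▸ S.mono.monotone n.zero_le

theorem exists_mem_Ico_tau {t : ℝ} (ht : 0 ≤ t) : ∃ n, S.tau n ≤ t ∧ t < S.tau (n + 1) := by
  classical
  have hex : ∃ n, t < S.tau n := (S.tends.eventually_gt_atTop t).exists
  have hpos : Nat.find hex ≠ 0 := fun h0 => by
    have := Nat.find_spec hex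
    rw [h0, S.tau0] at this
    linarith
  obtain ⟨n, hn⟩ := Nat.exists_eq_succ_of_ne_zero hpos
  exact ⟨n, not_lt.1 (Nat.find_min hex (by omega)), by simpa [hn] using Nat.find_spec hex⟩

theorem tau_le_iff {n i : ℕ} {t : ℝ} (h : S.tau n ≤ t) (h' : t < S.tau (n + 1)) :
    S.tau i ≤ t ↔ i ≤ n := by
  constructor
  · intro hi
    exact Nat.lt_succ_iff.1 (S.mono.lt_iff_lt.1 (hi.trans_lt h'))
  · intro hi
    exact (S.mono.monotone hi).trans h

theorem N_eq {n : ℕ} {t : ℝ} (h : S.tau n ≤ t) (h' : t < S.tau (n + 1)) : S.N 0 t = n := by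
  have : {i : ℕ | 0 < S.tau i ∧ S.tau i ≤ t} = (Finset.Ioc 0 n : Finset ℕ) := by
    ext i
    have h0 : 0 < S.tau i ↔ 0 < i := by
      rw [← S.mono.lt_iff_lt, S.tau0]
    simp [S.tau_le_iff h h', h0]
  rw [N, this, Set.ncard_coe_finset]
  simp

open Classical in
theorem Ntrans_eq {n : ℕ} {t : ℝ} (h : S.tau n ≤ t) (h' : t < S.tau (n + 1)) (p : P × P) :
    S.Ntrans p.1 p.2 t =
      ((Finset.range n).filter fun i => (S.sig (S.tau i), S.sig (S.tau (i + 1))) = p).card := by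
  rw [Ntrans, ← Set.ncard_coe_finset]
  congr 1
  ext i
  simp [S.tau_le_iff h h', Prod.ext_iff]

theorem sum_mul_Ntrans {n : ℕ} {t : ℝ} (h : S.tau n ≤ t) (h' : t < S.tau (n + 1))
    {A : Finset (P × P)} (hadm : ∀ i : ℕ, (S.sig (S.tau i), S.sig (S.tau (i + 1))) ∈ A)
    (g : P × P → ℝ) :
    ∑ p ∈ A, g p * S.Ntrans p.1 p.2 t =
      ∑ i ∈ Finset.range n, g (S.sig (S.tau i), S.sig (S.tau (i + 1))) := by
  classical
  rw [← Finset.sum_fiberwise_of_maps_to' (fun i _ => hadm i) g]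
  refine Finset.sum_congr rfl fun p _ => ?_
  rw [S.Ntrans_eq h h', Finset.sum_const, nsmul_eq_mul, mul_comm]

theorem mul_nu_mul_sum_rho {t : ℝ} (ht : 0 < t) (A : Finset (P × P)) (g : P × P → ℝ) :
    t * (S.nu t * ∑ p ∈ A, g p * S.rho p.1 p.2 t) = ∑ p ∈ A, g p * S.Ntrans p.1 p.2 t := by
  rw [← mul_assoc, Finset.mul_sum]
  refine Finset.sum_congr rfl fun p _ => ?_
  rw [nu, rho, mul_div_cancel₀ _ ht.ne']
  by_cases hN : S.N 0 t = 0
  · obtain ⟨n, h, h'⟩ := S.exists_mem_Ico_tau ht.le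
    have hn : n = 0 := (S.N_eq h h').symm.trans hN
    subst hn
    classical
    simp [S.Ntrans_eq h h']
  · have : (S.N 0 t : ℝ) ≠ 0 := Nat.cast_ne_zero.2 hN
    field_simp

theorem T_add (j : P) {a b c : ℝ} (hab : a ≤ b) (hbc : b ≤ c) :
    S.T j a c = S.T j a b + S.T j b c := by
  have hfin : ∀ u v : ℝ, volume {r : ℝ | u < r ∧ r ≤ v ∧ S.sig r = j} ≠ ⊤ := fun u v =>
    ne_top_of_le_ne_top (by simp : volume (Ioc u v) ≠ ⊤) (measure_mono fun r hr => ⟨hr.1, hr.2.1⟩)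
  rw [T, T, T, ← ENNReal.toReal_add (hfin a b) (hfin b c),
    ← measure_inter_add_sdiff {r : ℝ | a < r ∧ r ≤ c ∧ S.sig r = j} (measurableSet_Iic (a := b))]
  congr 3
  · ext r
    simp only [mem_inter_iff, mem_ofPred_eq, mem_Iic]
    constructor
    · rintro ⟨⟨h1, -, h3⟩, h4⟩
      exact ⟨h1, h4, h3⟩
    · rintro ⟨h1, h2, h3⟩
      exact ⟨⟨h1, h2.trans hbc, h3⟩, h2⟩
  · ext r
    simp only [Set.mem_sdiff, mem_ofPred_eq, mem_Iic, not_le]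
    constructor
    · rintro ⟨⟨-, h2, h3⟩, h4⟩
      exact ⟨h4, h2, h3⟩
    · rintro ⟨h1, h2, h3⟩
      exact ⟨⟨hab.trans_lt h1, h2, h3⟩, h1⟩

theorem T_self (j : P) (a : ℝ) : S.T j a a = 0 := by
  have : {r : ℝ | a < r ∧ r ≤ a ∧ S.sig r = j} = ∅ := by
    ext r
    simp only [mem_ofPred_eq, mem_empty_iff_false, iff_false]
    rintro ⟨h1, h2, -⟩
    linarith
  simp [T, this]

theorem T_sig_tau {n : ℕ} {b : ℝ} (h : S.tau n ≤ b) (h' : b ≤ S.tau (n + 1)) :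
    S.T (S.sig (S.tau n)) (S.tau n) b = b - S.tau n := by
  have hvol : volume {r : ℝ | S.tau n < r ∧ r ≤ b ∧ S.sig r = S.sig (S.tau n)} =
      ENNReal.ofReal (b - S.tau n) := by
    refine le_antisymm ?_ ?_
    · rw [← Real.volume_Ioc]
      exact measure_mono fun r hr => ⟨hr.1, hr.2.1⟩
    · rw [← Real.volume_Ioo]
      exact measure_mono fun r hr =>
        ⟨hr.1, hr.2.le, S.const n r hr.1.le (hr.2.trans_le h')⟩
  rw [T, hvol, ENNReal.toReal_ofReal (by linarith)]

theorem T_of_ne {n : ℕ} {b : ℝ} (h' : b ≤ S.tau (n + 1)) {j : P} (hj : j ≠ S.sig (S.tau n)) :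
    S.T j (S.tau n) b = 0 := by
  have hvol : volume {r : ℝ | S.tau n < r ∧ r ≤ b ∧ S.sig r = j} = 0 := by
    refine measure_mono_null (t := {b}) (fun r hr => ?_) (by simp)
    refine hr.2.1.eq_of_not_lt fun hlt => hj ?_
    rw [← hr.2.2, S.const n r hr.1.le (hlt.trans_le h')]
  rw [T, hvol, ENNReal.toReal_zero]

/-- Over an inter-switch interval the weighted activation time grows at the rate of the active
mode. -/
theorem sum_mul_T_add (lam : P → ℝ) {Q : Finset P} {n : ℕ} {b : ℝ} (hQ : S.sig (S.tau n) ∈ Q)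
    (h : S.tau n ≤ b) (h' : b ≤ S.tau (n + 1)) :
    ∑ j ∈ Q, lam j * S.T j 0 b =
      ∑ j ∈ Q, lam j * S.T j 0 (S.tau n) + lam (S.sig (S.tau n)) * (b - S.tau n) := by
  have hsum : ∑ j ∈ Q, lam j * S.T j (S.tau n) b = lam (S.sig (S.tau n)) * (b - S.tau n) := by
    rw [Finset.sum_eq_single_of_mem _ hQ fun j _ hj => by rw [S.T_of_ne h' hj, mul_zero],
      S.T_sig_tau h h']
  rw [← hsum, ← Finset.sum_add_distrib]
  refine Finset.sum_congr rfl fun j _ => ?_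
  rw [S.T_add j (S.tau_nonneg n) h, mul_add]

end SwitchSig

/-- Decay of the active Lyapunov-like function over one inter-switch interval. -/
theorem IsSolution.lyapunov_le {P E : Type*} [NormedAddCommGroup E] [NormedSpace ℝ E]
    [CompleteSpace E] {S : SwitchSig P} {f : P → E → E} {V : P → E → ℝ} {lam : P → ℝ}
    {PS PU : Finset P} {lo hi : ℝ → ℝ} (hLip : ∀ i : P, ∃ K : NNReal, LipschitzWith K (f i))
    (h1 : Assumption1 f V lam PS PU lo hi) {x : ℝ → E} (hx : IsSolution S f x)
    {n : ℕ} {b : ℝ} (h : S.tau n ≤ b) (h' : b ≤ S.tau (n + 1)) :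
    V (S.sig (S.tau n)) (x b) ≤ V (S.sig (S.tau n)) (x (S.tau n)) *
      Real.exp (-(lam (S.sig (S.tau n)) * (b - S.tau n))) := by
  obtain ⟨-, -, -, -, -, -, -, hdecay⟩ := h1
  obtain ⟨K, hK⟩ := hLip (S.sig (S.tau n))
  rcases h.eq_or_lt with rfl | hlt
  · simp
  have hsol : SolvesOn (f (S.sig (S.tau n))) x (S.tau n) b := by
    refine ⟨hx.1.mono fun r hr => (S.tau_nonneg n).trans hr.1, fun r hr => ?_⟩
    have hr' := hr.2.trans_le h'
    simpa only [S.const n r hr.1.le hr'] using hx.2 n r hr.1 hr'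
  obtain ⟨δ, hδx, hδc, hδ⟩ := hsol.exists_extension hK hlt
  have key := hdecay (S.sig (S.tau n)) (fun s => δ (S.tau n + s)) ?_ ?_ (b - S.tau n)
    (by linarith)
  · rw [add_sub_cancel, add_zero, hδx (mem_Iic.2 le_rfl), hδx (mem_Iic.2 h), neg_mul] at key
    exact key
  · exact hδc.comp (by fun_prop) fun s hs => by
      have : (0 : ℝ) ≤ s := hs
      exact mem_Ici.2 (by linarith)
  · intro s hs
    exact (hδ (S.tau n + s) (by linarith)).comp_const_add (S.tau n) s

theorem stmt6 {d : ℕ} {P : Type*}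
    (S : SwitchSig P)
    (f : P → EuclideanSpace ℝ (Fin d) → EuclideanSpace ℝ (Fin d))
    (PS PU : Finset P) (Eadm : Finset (P × P))
    (V : P → EuclideanSpace ℝ (Fin d) → ℝ) (lam : P → ℝ) (mu : P → P → ℝ)
    (lo hi : ℝ → ℝ)
    (hcover : ∀ i : P, i ∈ PS ∨ i ∈ PU) (hdisj : Disjoint PS PU)
    (hLip : ∀ i : P, ∃ K : NNReal, LipschitzWith K (f i))
    (hzero : ∀ i : P, f i 0 = 0)
    (hadm : ∀ i : ℕ, (S.sig (S.tau i), S.sig (S.tau (i + 1))) ∈ Eadm)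
    (h1 : Assumption1 f V lam PS PU lo hi)
    (h2 : Assumption2 V mu Eadm)
    (x : ℝ → EuclideanSpace ℝ (Fin d)) (hx : IsSolution S f x)
    (t : ℝ) (ht : 0 < t) :
    V (S.sig t) (x t) ≤
      V (S.sig 0) (x 0) *
        Real.exp (t *
          (S.nu t * ∑ p ∈ Eadm, Real.log (mu p.1 p.2) * S.rho p.1 p.2 t
            - ∑ j ∈ PS, |lam j| * S.eta j t
            + ∑ k ∈ PU, |lam k| * S.eta k t)) := by
  have hstep := fun (n : ℕ) (b : ℝ) (h : S.tau n ≤ b) (h' : b ≤ S.tau (n + 1)) =>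
    hx.lyapunov_le hLip h1 h h'
  obtain ⟨-, -, -, -, hS, hU, -, -⟩ := h1
  have hmem : ∀ i, i ∈ PS.disjUnion PU hdisj := fun i => by simpa using hcover i
  set Λ : ℝ → ℝ := fun s => ∑ j ∈ PS.disjUnion PU hdisj, lam j * S.T j 0 s with hΛ
  set L : ℕ → ℝ := fun n => ∑ i ∈ Finset.range n,
    Real.log (mu (S.sig (S.tau i)) (S.sig (S.tau (i + 1)))) with hL
  have hΛadd : ∀ (n : ℕ) (b : ℝ), S.tau n ≤ b → b ≤ S.tau (n + 1) →
      Λ b = Λ (S.tau n) + lam (S.sig (S.tau n)) * (b - S.tau n) :=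
    fun n b h h' => S.sum_mul_T_add lam (hmem _) h h'
  have hseg : ∀ (n : ℕ) (b : ℝ), S.tau n ≤ b → b ≤ S.tau (n + 1) →
      V (S.sig (S.tau n)) (x (S.tau n)) ≤ V (S.sig 0) (x 0) * Real.exp (L n - Λ (S.tau n)) →
      V (S.sig (S.tau n)) (x b) ≤ V (S.sig 0) (x 0) * Real.exp (L n - Λ b) := by
    intro n b h h' hn
    calc V (S.sig (S.tau n)) (x b)
        ≤ V (S.sig (S.tau n)) (x (S.tau n)) *
          Real.exp (-(lam (S.sig (S.tau n)) * (b - S.tau n))) := hstep n b h h'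
      _ ≤ V (S.sig 0) (x 0) * Real.exp (L n - Λ (S.tau n)) *
          Real.exp (-(lam (S.sig (S.tau n)) * (b - S.tau n))) := by gcongr
      _ = V (S.sig 0) (x 0) * Real.exp (L n - Λ b) := by
        rw [mul_assoc, ← Real.exp_add, hΛadd n b h h']
        congr 2
        ring
  have hswitch : ∀ n : ℕ,
      V (S.sig (S.tau n)) (x (S.tau n)) ≤ V (S.sig 0) (x 0) * Real.exp (L n - Λ (S.tau n)) := by
    intro n
    induction n with
    | zero => simp [hL, hΛ, S.tau0, S.T_self]
    | succ n ih =>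
      obtain ⟨hmu, hV⟩ := h2 _ (hadm n)
      have hpos := one_pos.trans_le hmu
      have hLn : L (n + 1) = L n + Real.log (mu (S.sig (S.tau n)) (S.sig (S.tau (n + 1)))) :=
        Finset.sum_range_succ _ n
      calc V (S.sig (S.tau (n + 1))) (x (S.tau (n + 1)))
          ≤ mu (S.sig (S.tau n)) (S.sig (S.tau (n + 1))) *
            V (S.sig (S.tau n)) (x (S.tau (n + 1))) := hV _
        _ ≤ mu (S.sig (S.tau n)) (S.sig (S.tau (n + 1))) *
            (V (S.sig 0) (x 0) * Real.exp (L n - Λ (S.tau (n + 1)))) :=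
          mul_le_mul_of_nonneg_left
            (hseg n _ (S.mono n.lt_succ_self).le le_rfl ih) hpos.le
        _ = V (S.sig 0) (x 0) * Real.exp (L (n + 1) - Λ (S.tau (n + 1))) := by
          rw [hLn, add_sub_right_comm, Real.exp_add, Real.exp_log hpos]
          ring
  obtain ⟨n, h, h'⟩ := S.exists_mem_Ico_tau ht.le
  have hfinal := hseg n t h h'.le (hswitch n)
  rw [← S.const n t h h'] at hfinal
  have heta : ∀ j, t * S.eta j t = S.T j 0 t := fun j => mul_div_cancel₀ _ ht.ne'
  have hexp : t * (S.nu t * ∑ p ∈ Eadm, Real.log (mu p.1 p.2) * S.rho p.1 p.2 t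
      - ∑ j ∈ PS, |lam j| * S.eta j t + ∑ k ∈ PU, |lam k| * S.eta k t) = L n - Λ t := by
    have hPS : t * ∑ j ∈ PS, |lam j| * S.eta j t = ∑ j ∈ PS, lam j * S.T j 0 t := by
      rw [Finset.mul_sum]
      refine Finset.sum_congr rfl fun j hj => ?_
      rw [abs_of_pos (hS j hj), mul_left_comm, heta]
    have hPU : t * ∑ k ∈ PU, |lam k| * S.eta k t = -∑ k ∈ PU, lam k * S.T k 0 t := by
      rw [Finset.mul_sum, ← Finset.sum_neg_distrib]
      refine Finset.sum_congr rfl fun k hk => ?_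
      rw [abs_of_neg (hU k hk), mul_left_comm, heta, neg_mul]
    rw [mul_add, mul_sub, hPS, hPU,
      S.mul_nu_mul_sum_rho ht Eadm (fun p => Real.log (mu p.1 p.2)),
      S.sum_mul_Ntrans h h' hadm (fun p => Real.log (mu p.1 p.2))]
    simp only [hL, hΛ, Finset.sum_disjUnion]
    ring
  rwa [hexp]
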